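/- For n ≤ l−2, the set of Weyl elements w of SO_{2l} such that the Bruhat cell C(w) is contained in P_{n,1^{l−n}} w̃_n P_{n,1^{l−n}} equals the Bruhat interval [w̃_n, w_l^{L} w̃_n], where P_{n,1^{l−n}} is the standard parabolic with Levi GL_n × GL_1^{l−n} and w_l^{L} is the long Weyl element of that Levi. In particular w̃_n is the minimal and w_l^{L} w̃_n the maximal element of the double coset W_L w̃_n W_L in Bruhat order, and every element of this double coset factors uniquely as w̃_n w' with w' ∈ W_L and l(w̃_n w') = l(w̃_n) + l(w'). -/

import Mathlib

open Matrix

noncomputable section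

/-- The order-reversing involution `i ↦ 2l-1-i` of `Fin (2l)`. -/
def revF (l : ℕ) (i : Fin (2*l)) : Fin (2*l) :=
  ⟨2*l-1-(i:ℕ), by have := i.isLt; omega⟩

/-- Membership in the Weyl group of type `D_l`, realized as the group of permutations of
`Fin (2l)` commuting with `rev` and with an even number of "sign changes". -/
def inWeylD (l : ℕ) (σ : Equiv.Perm (Fin (2*l))) : Prop :=
  (∀ i, σ (revF l i) = revF l (σ i)) ∧
  Even (Finset.univ.filter
    (fun i : Fin (2*l) => (i:ℕ) < l ∧ l ≤ ((σ i : Fin (2*l)) : ℕ))).card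

/-- The action of a (signed) permutation on root vectors `v : Fin l → ℤ`
(in the basis `e_1, …, e_l`). -/
def actD (l : ℕ) (σ : Equiv.Perm (Fin (2*l))) (v : Fin l → ℤ) : Fin l → ℤ :=
  fun k => ∑ i : Fin l,
    v i * (if ((σ (Fin.castLE (by omega) i) : Fin (2*l)) : ℕ) = (k:ℕ) then 1
      else if ((σ (Fin.castLE (by omega) i) : Fin (2*l)) : ℕ) = 2*l-1-(k:ℕ) then -1 else 0)

/-- The roots of type `D_l`: `±e_i ± e_j`, `i < j`. -/
def isRootD (l : ℕ) (v : Fin l → ℤ) : Prop :=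
  ∃ i j : Fin l, (i:ℕ) < (j:ℕ) ∧ ∃ a b : ℤ, (a = 1 ∨ a = -1) ∧ (b = 1 ∨ b = -1) ∧
    v = fun k => if k = i then a else if k = j then b else 0

/-- Positive roots: the first nonzero coordinate is `+1`. -/
def isPosRootD (l : ℕ) (v : Fin l → ℤ) : Prop :=
  isRootD l v ∧ ∃ i : Fin l, v i = 1 ∧ ∀ j : Fin l, (j:ℕ) < (i:ℕ) → v j = 0

/-- Negative roots: the first nonzero coordinate is `-1`. -/
def isNegRootD (l : ℕ) (v : Fin l → ℤ) : Prop :=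
  isRootD l v ∧ ∃ i : Fin l, v i = -1 ∧ ∀ j : Fin l, (j:ℕ) < (i:ℕ) → v j = 0

/-- The simple roots `Δ = {α_1, …, α_l}` of `D_l`:
`α_k = e_k - e_{k+1}` (`k ≤ l-1`) and `α_l = e_{l-1} + e_l`. -/
def simpleSetD (l : ℕ) : Set (Fin l → ℤ) :=
  {v | (∃ k : ℕ, k + 2 ≤ l ∧
          v = fun j : Fin l => if (j:ℕ) = k then 1 else if (j:ℕ) = k+1 then (-1 : ℤ) else 0) ∨
       v = fun j : Fin l => if (j:ℕ) = l-2 ∨ (j:ℕ) = l-1 then (1 : ℤ) else 0}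

/-- The Bessel support `B(SO_{2l})`: Weyl elements sending every simple root to a
negative or simple root. -/
def inBesselD (l : ℕ) (σ : Equiv.Perm (Fin (2*l))) : Prop :=
  inWeylD l σ ∧ ∀ v ∈ simpleSetD l, isNegRootD l (actD l σ v) ∨ actD l σ v ∈ simpleSetD l

/-- `θ_w = {α ∈ Δ : wα > 0}`. -/
def thetaD (l : ℕ) (σ : Equiv.Perm (Fin (2*l))) : Set (Fin l → ℤ) :=
  {v | v ∈ simpleSetD l ∧ isPosRootD l (actD l σ v)}

/-- The length of a Weyl element: the number of positive roots made negative. -/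
def lenD (l : ℕ) (σ : Equiv.Perm (Fin (2*l))) : ℕ :=
  Set.ncard {v | isPosRootD l v ∧ isNegRootD l (actD l σ v)}

/-- Reflections of `W(D_l)` in this realization. -/
def isReflD (l : ℕ) (τ : Equiv.Perm (Fin (2*l))) : Prop :=
  ∃ a b : Fin (2*l), a ≠ b ∧ a ≠ revF l b ∧
    τ = Equiv.swap a b * Equiv.swap (revF l a) (revF l b)

/-- The (combinatorial) Bruhat order: `x ≤ y` iff there is a chain from `x` to `y`
multiplying by reflections and increasing length at each step. -/
def bruhatLE (l : ℕ) : Equiv.Perm (Fin (2*l)) → Equiv.Perm (Fin (2*l)) → Prop :=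
  Relation.ReflTransGen
    (fun x y => (∃ τ, isReflD l τ ∧ y = τ * x) ∧ lenD l x < lenD l y)

/-- An explicit permutation of `Fin N` built from an involutive function on `ℕ`. -/
def natPerm (N : ℕ) (g : ℕ → ℕ) (h1 : ∀ x, x < N → g x < N)
    (h2 : ∀ x, x < N → g (g x) = x) : Equiv.Perm (Fin N) where
  toFun := fun i => ⟨g i, h1 i i.isLt⟩
  invFun := fun i => ⟨g i, h1 i i.isLt⟩
  left_inv := fun i => Fin.ext (h2 i i.isLt)
  right_inv := fun i => Fin.ext (h2 i i.isLt)

/-- The underlying function of the Weyl representative `w̃_n`. -/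
def wtnFun (l n : ℕ) (x : ℕ) : ℕ :=
  if x < n then x + (2*l - n)
  else if 2*l - n ≤ x then x - (2*l - n)
  else if n % 2 = 1 ∧ x = l - 1 then l
  else if n % 2 = 1 ∧ x = l then l - 1
  else x

lemma wtnFun_lt (l n : ℕ) (h : n + 1 ≤ l) : ∀ x, x < 2*l → wtnFun l n x < 2*l := by
  intro x hx; unfold wtnFun; split_ifs <;> omega

lemma wtnFun_invol (l n : ℕ) (h : n + 1 ≤ l) : ∀ x, x < 2*l → wtnFun l n (wtnFun l n x) = x := by
  intro x hx; unfold wtnFun; split_ifs <;> omega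

/-- The Weyl representative `w̃_n` as a permutation of `Fin (2l)`:
`I_n` corners, `J_2^n` center. -/
def wtnPerm (l n : ℕ) : Equiv.Perm (Fin (2*l)) :=
  if h : n + 1 ≤ l then natPerm (2*l) (wtnFun l n) (wtnFun_lt l n h) (wtnFun_invol l n h)
  else 1

def shFun (l x : ℕ) : ℕ := if x < l then x + l else x - l

lemma shFun_lt (l : ℕ) : ∀ x, x < 2*l → shFun l x < 2*l := by
  intro x hx; unfold shFun; split_ifs <;> omega

lemma shFun_invol (l : ℕ) : ∀ x, x < 2*l → shFun l (shFun l x) = x := by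
  intro x hx; unfold shFun; split_ifs <;> omega

/-- The permutation swapping the two halves of `Fin (2l)` (the element `[[0,I_l],[I_l,0]]`). -/
def shPerm (l : ℕ) : Equiv.Perm (Fin (2*l)) := natPerm (2*l) (shFun l) (shFun_lt l) (shFun_invol l)

def cswapFun (l x : ℕ) : ℕ := if x = l - 1 then l else if x = l then l - 1 else x

lemma cswapFun_lt (l : ℕ) : ∀ x, x < 2*l → cswapFun l x < 2*l := by
  intro x hx; unfold cswapFun; split_ifs <;> omega

lemma cswapFun_invol (l : ℕ) : ∀ x, x < 2*l → cswapFun l (cswapFun l x) = x := by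
  intro x hx; unfold cswapFun; split_ifs <;> omega

/-- The outer automorphism `c`: the transposition of `l-1` and `l` (0-indexed). -/
def cswapPerm (l : ℕ) : Equiv.Perm (Fin (2*l)) :=
  natPerm (2*l) (cswapFun l) (cswapFun_lt l) (cswapFun_invol l)

def endSwapFun (l x : ℕ) : ℕ := if x = 0 then 2*l - 1 else if x = 2*l - 1 then 0 else x

lemma endSwapFun_lt (l : ℕ) : ∀ x, x < 2*l → endSwapFun l x < 2*l := by
  intro x hx; unfold endSwapFun; split_ifs <;> omega

lemma endSwapFun_invol (l : ℕ) : ∀ x, x < 2*l → endSwapFun l (endSwapFun l x) = x := by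
  intro x hx; unfold endSwapFun; split_ifs <;> omega

def endSwapPerm (l : ℕ) : Equiv.Perm (Fin (2*l)) :=
  natPerm (2*l) (endSwapFun l) (endSwapFun_lt l) (endSwapFun_invol l)

/-- The Weyl representative `w̃_l` (with `θ_{w̃_l} = Δ ∖ {α_l}`): for `l` even the
half-swap `w̃'_l = [[0,I_l],[I_l,0]]`, and for `l` odd its conjugate by `c`. -/
def wtlPerm (l : ℕ) : Equiv.Perm (Fin (2*l)) :=
  if l % 2 = 1 then cswapPerm l * (shPerm l * endSwapPerm l) * cswapPerm l else shPerm l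

/-- `w̃_l^c = c w̃_l c`. -/
def wtlcPerm (l : ℕ) : Equiv.Perm (Fin (2*l)) := cswapPerm l * wtlPerm l * cswapPerm l

def wlongGLFun (l x : ℕ) : ℕ := if x < l then l - 1 - x else 3*l - 1 - x

lemma wlongGLFun_lt (l : ℕ) : ∀ x, x < 2*l → wlongGLFun l x < 2*l := by
  intro x hx; unfold wlongGLFun; split_ifs <;> omega

lemma wlongGLFun_invol (l : ℕ) : ∀ x, x < 2*l → wlongGLFun l (wlongGLFun l x) = x := by
  intro x hx; unfold wlongGLFun; split_ifs <;> omega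

/-- The long Weyl element of the Siegel Levi `L_l ≅ GL_l`, i.e. `t_l(J_l)`. -/
def wlongGLPerm (l : ℕ) : Equiv.Perm (Fin (2*l)) :=
  natPerm (2*l) (wlongGLFun l) (wlongGLFun_lt l) (wlongGLFun_invol l)

def wlongGLm1Fun (l x : ℕ) : ℕ :=
  if x < l - 1 then l - 2 - x else if l + 1 ≤ x then 3*l - x else x

lemma wlongGLm1Fun_lt (l : ℕ) : ∀ x, x < 2*l → wlongGLm1Fun l x < 2*l := by
  intro x hx; unfold wlongGLm1Fun; split_ifs <;> omega

lemma wlongGLm1Fun_invol (l : ℕ) : ∀ x, x < 2*l → wlongGLm1Fun l (wlongGLm1Fun l x) = x := by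
  intro x hx; unfold wlongGLm1Fun; split_ifs <;> omega

/-- The long Weyl element of the Levi `L_{l-1,1} ≅ GL_{l-1} × GL_1`. -/
def wlongGLm1Perm (l : ℕ) : Equiv.Perm (Fin (2*l)) :=
  natPerm (2*l) (wlongGLm1Fun l) (wlongGLm1Fun_lt l) (wlongGLm1Fun_invol l)

def wlongLnFun (l n x : ℕ) : ℕ :=
  if x < n then n - 1 - x else if 2*l - n ≤ x then 4*l - 1 - n - x else x

lemma wlongLnFun_lt (l n : ℕ) (h : n ≤ l) : ∀ x, x < 2*l → wlongLnFun l n x < 2*l := by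
  intro x hx; unfold wlongLnFun; split_ifs <;> omega

lemma wlongLnFun_invol (l n : ℕ) (h : n ≤ l) :
    ∀ x, x < 2*l → wlongLnFun l n (wlongLnFun l n x) = x := by
  intro x hx; unfold wlongLnFun; split_ifs <;> omega

/-- The long Weyl element of the Levi `L_{n,1^{l-n}} ≅ GL_n × GL_1^{l-n}`. -/
def wlongLnPerm (l n : ℕ) : Equiv.Perm (Fin (2*l)) :=
  if h : n ≤ l then natPerm (2*l) (wlongLnFun l n) (wlongLnFun_lt l n h) (wlongLnFun_invol l n h)
  else 1

/-- `τ` is the image `t_n(w')` of an element `w'` of the Weyl group `W(GL_n)`: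
it preserves the first block `{0,…,n-1}`, fixes the middle `[n, 2l-n)` pointwise, and
commutes with `rev`. -/
def isGLnBlock (l n : ℕ) (τ : Equiv.Perm (Fin (2*l))) : Prop :=
  (∀ i : Fin (2*l), (i:ℕ) < n → ((τ i : Fin (2*l)) : ℕ) < n) ∧
  (∀ i : Fin (2*l), n ≤ (i:ℕ) → (i:ℕ) < 2*l - n → τ i = i) ∧
  (∀ i, τ (revF l i) = revF l (τ i))

def Jmat (F : Type*) [Field F] (n : ℕ) : Matrix (Fin n) (Fin n) F :=
  Matrix.of fun i j => if (i : ℕ) + (j : ℕ) + 1 = n then 1 else 0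

def inSO (F : Type*) [Field F] (n : ℕ) (g : Matrix (Fin n) (Fin n) F) : Prop :=
  g.det = 1 ∧ gᵀ * Jmat F n * g = Jmat F n

/-- The Borel subgroup `B` of `SO_{2l}(F)`: upper triangular elements. -/
def inBorel (F : Type*) [Field F] (l : ℕ) (g : Matrix (Fin (2*l)) (Fin (2*l)) F) : Prop :=
  inSO F (2*l) g ∧ ∀ i j : Fin (2*l), (j:ℕ) < (i:ℕ) → g i j = 0

/-- `g` is a monomial representative in `SO_{2l}(F)` of the Weyl element `σ`. -/
def isWeylRep (F : Type*) [Field F] (l : ℕ) (σ : Equiv.Perm (Fin (2*l)))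
    (g : Matrix (Fin (2*l)) (Fin (2*l)) F) : Prop :=
  inSO F (2*l) g ∧ ∀ i j : Fin (2*l), (g i j ≠ 0 ↔ σ j = i)

/-- Block index of the partition `(n, 1^{l-n}, 1^{l-n}, n)` underlying the standard
parabolic `P_{n,1^{l-n}}` with Levi `GL_n × GL_1^{l-n}`. -/
def blkP (l n x : ℕ) : ℕ :=
  if x < n then 0 else if x < 2*l - n then x - n + 1 else 2*l - 2*n + 1

/-- The standard parabolic subgroup `P_{n,1^{l-n}}` of `SO_{2l}(F)`. -/
def inPn1 (F : Type*) [Field F] (l n : ℕ) (g : Matrix (Fin (2*l)) (Fin (2*l)) F) : Prop :=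
  inSO F (2*l) g ∧ ∀ i j : Fin (2*l), blkP l n (j:ℕ) < blkP l n (i:ℕ) → g i j = 0

/-- The Bruhat cell `C(σ) = B σ B`. -/
def bruhatCell (F : Type*) [Field F] (l : ℕ) (σ : Equiv.Perm (Fin (2*l))) :
    Set (Matrix (Fin (2*l)) (Fin (2*l)) F) :=
  {x | ∃ b1 gw b2, inBorel F l b1 ∧ isWeylRep F l σ gw ∧ inBorel F l b2 ∧ x = b1 * gw * b2}

/-- The double coset `P_{n,1^{l-n}} w̃_n P_{n,1^{l-n}}`. -/
def PwP (F : Type*) [Field F] (l n : ℕ) : Set (Matrix (Fin (2*l)) (Fin (2*l)) F) :=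
  {x | ∃ p1 gw p2, inPn1 F l n p1 ∧ isWeylRep F l (wtnPerm l n) gw ∧ inPn1 F l n p2 ∧
    x = p1 * gw * p2}

/-! ### Reflections and signed permutations -/

lemma revF_revF (l : ℕ) (i : Fin (2*l)) : revF l (revF l i) = i := by
  have := i.isLt
  ext; simp only [revF]; omega

lemma revF_inj {l : ℕ} {i j : Fin (2*l)} : revF l i = revF l j ↔ i = j :=
  ⟨fun h => by rw [← revF_revF l i, h, revF_revF], fun h => by rw [h]⟩

lemma revF_lt {l : ℕ} {i j : Fin (2*l)} : revF l i < revF l j ↔ j < i := by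
  have := i.isLt
  have := j.isLt
  simp only [Fin.lt_def, revF]; omega

lemma revF_ne (l : ℕ) (i : Fin (2*l)) : revF l i ≠ i := by
  have := i.isLt
  rw [Ne, Fin.ext_iff]; simp only [revF]; omega

/-- Signed permutations: the permutations commuting with `revF`. -/
def IsSigned (l : ℕ) (x : Equiv.Perm (Fin (2*l))) : Prop :=
  ∀ i, x (revF l i) = revF l (x i)

lemma IsSigned.mul {l : ℕ} {x y : Equiv.Perm (Fin (2*l))} (hx : IsSigned l x)
    (hy : IsSigned l y) : IsSigned l (x * y) := fun i => by
  rw [Equiv.Perm.mul_apply, hy, hx, Equiv.Perm.mul_apply]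

lemma IsSigned.inv {l : ℕ} {x : Equiv.Perm (Fin (2*l))} (hx : IsSigned l x) :
    IsSigned l x⁻¹ := fun i => by
  rw [Equiv.Perm.inv_eq_iff_eq, hx]
  simp

/-- The reflection exchanging `p` with `q` and `revF l p` with `revF l q`. -/
def reflD (l : ℕ) (p q : Fin (2*l)) : Equiv.Perm (Fin (2*l)) :=
  Equiv.swap p q * Equiv.swap (revF l p) (revF l q)

lemma reflD_comm (l : ℕ) (p q : Fin (2*l)) : reflD l p q = reflD l q p := by
  rw [reflD, reflD, Equiv.swap_comm p, Equiv.swap_comm (revF l p)]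

section reflD

variable {l : ℕ} {p q : Fin (2*l)}

lemma ne_revF_symm (h : p ≠ revF l q) : q ≠ revF l p := fun h' => h (by rw [h', revF_revF])

lemma reflD_left (h : p ≠ revF l q) : reflD l p q p = q := by
  rw [reflD, Equiv.Perm.mul_apply, Equiv.swap_apply_of_ne_of_ne (revF_ne l p).symm h,
    Equiv.swap_apply_left]

lemma reflD_right (h : p ≠ revF l q) : reflD l p q q = p := by
  rw [reflD_comm, reflD_left (ne_revF_symm h)]

lemma reflD_revF_left (h : p ≠ revF l q) : reflD l p q (revF l p) = revF l q := by
  rw [reflD, Equiv.Perm.mul_apply, Equiv.swap_apply_left,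
    Equiv.swap_apply_of_ne_of_ne h.symm (revF_ne l q)]

lemma reflD_revF_right (h : p ≠ revF l q) : reflD l p q (revF l q) = revF l p := by
  rw [reflD_comm, reflD_revF_left (ne_revF_symm h)]

lemma reflD_of_ne {i : Fin (2*l)} (h1 : i ≠ p) (h2 : i ≠ q) (h3 : i ≠ revF l p)
    (h4 : i ≠ revF l q) : reflD l p q i = i := by
  rw [reflD, Equiv.Perm.mul_apply, Equiv.swap_apply_of_ne_of_ne h3 h4,
    Equiv.swap_apply_of_ne_of_ne h1 h2]

lemma reflD_cases (h : p ≠ revF l q) (i : Fin (2*l)) :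
    (i = p ∧ reflD l p q i = q) ∨ (i = q ∧ reflD l p q i = p) ∨
    (i = revF l p ∧ reflD l p q i = revF l q) ∨ (i = revF l q ∧ reflD l p q i = revF l p) ∨
    reflD l p q i = i := by
  by_cases h1 : i = p
  · exact Or.inl ⟨h1, by rw [h1, reflD_left h]⟩
  by_cases h2 : i = q
  · exact Or.inr (Or.inl ⟨h2, by rw [h2, reflD_right h]⟩)
  by_cases h3 : i = revF l p
  · exact Or.inr (Or.inr (Or.inl ⟨h3, by rw [h3, reflD_revF_left h]⟩))
  by_cases h4 : i = revF l q
  · exact Or.inr (Or.inr (Or.inr (Or.inl ⟨h4, by rw [h4, reflD_revF_right h]⟩)))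
  exact Or.inr (Or.inr (Or.inr (Or.inr (reflD_of_ne h1 h2 h3 h4))))

lemma reflD_apply_apply (h : p ≠ revF l q) (i : Fin (2*l)) :
    reflD l p q (reflD l p q i) = i := by
  rcases reflD_cases h i with ⟨rfl, h'⟩ | ⟨rfl, h'⟩ | ⟨rfl, h'⟩ | ⟨rfl, h'⟩ | h' <;>
    rw [h']
  · exact reflD_right h
  · exact reflD_left h
  · exact reflD_revF_right h
  · exact reflD_revF_left h
  · exact h'

lemma reflD_mul_self (h : p ≠ revF l q) : reflD l p q * reflD l p q = 1 :=
  Equiv.ext (reflD_apply_apply h)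

lemma isSigned_reflD (h : p ≠ revF l q) : IsSigned l (reflD l p q) := fun i => by
  rcases reflD_cases h i with ⟨rfl, h'⟩ | ⟨rfl, h'⟩ | ⟨rfl, h'⟩ | ⟨rfl, h'⟩ | h'
  · rw [reflD_revF_left h, h']
  · rw [reflD_revF_right h, h']
  · rw [h', revF_revF, revF_revF, reflD_left h]
  · rw [h', revF_revF, revF_revF, reflD_right h]
  · by_cases h1 : i = p
    · rw [h1, reflD_revF_left h, reflD_left h]
    by_cases h2 : i = q
    · rw [h2, reflD_revF_right h, reflD_right h]
    by_cases h3 : i = revF l p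
    · rw [h3, revF_revF, reflD_left h, reflD_revF_left h, revF_revF]
    by_cases h4 : i = revF l q
    · rw [h4, revF_revF, reflD_right h, reflD_revF_right h, revF_revF]
    rw [h', reflD_of_ne] <;> intro h5
    · exact h3 (by rw [← h5, revF_revF])
    · exact h4 (by rw [← h5, revF_revF])
    · exact h1 (revF_inj.1 h5)
    · exact h2 (revF_inj.1 h5)

end reflD

lemma IsSigned.mul_reflD {l : ℕ} {x : Equiv.Perm (Fin (2*l))} (hx : IsSigned l x)
    (p q : Fin (2*l)) : x * reflD l p q = reflD l (x p) (x q) * x := by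
  simp only [reflD, ← hx p, ← hx q, Equiv.swap_apply_apply]
  group

/-- A reflection in the position pair `p < q` can only turn a positive pair into a negative one
by acting monotonically on both of its entries. -/
lemma reflD_inversion {l : ℕ} {x : Equiv.Perm (Fin (2*l))} (hx : IsSigned l x)
    {p q i j : Fin (2*l)} (hpq : p < q) (hne : p ≠ revF l q) (hxpq : x p < x q)
    (hij : i < j) (ht : reflD l p q j < reflD l p q i) (hinv : x j < x i) :
    x (reflD l p q j) < x (reflD l p q i) := by
  have h1 : x (revF l q) < x (revF l p) := by rw [hx, hx, revF_lt]; exact hxpq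
  have h2 : revF l q < revF l p := revF_lt.2 hpq
  have h3 : (p : ℕ) + revF l p = 2*l-1 := by have := p.isLt; simp only [revF]; omega
  have h4 : (q : ℕ) + revF l q = 2*l-1 := by have := q.isLt; simp only [revF]; omega
  rw [Fin.lt_def] at *
  rcases reflD_cases hne i with ⟨hi, e⟩ | ⟨hi, e⟩ | ⟨hi, e⟩ | ⟨hi, e⟩ | e <;>
  rcases reflD_cases hne j with ⟨hj, f⟩ | ⟨hj, f⟩ | ⟨hj, f⟩ | ⟨hj, f⟩ | f <;>
  rw [e, f] at ht ⊢ <;> (try subst hi) <;> (try subst hj) <;> omega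

/-! ### Root vectors -/

/-- The vector `e_x`, with the convention `e_{revF x} = -e_x`. -/
def epsD (l : ℕ) (x : Fin (2*l)) : Fin l → ℤ := fun k =>
  if (x : ℕ) = (k:ℕ) then 1 else if (x : ℕ) = 2*l-1-(k:ℕ) then -1 else 0

lemma epsD_revF (l : ℕ) (x : Fin (2*l)) : epsD l (revF l x) = -epsD l x := by
  ext k
  have := x.isLt
  have := k.isLt
  simp only [epsD, revF, Pi.neg_apply]
  split_ifs <;> omega

lemma actD_sub (l : ℕ) (σ : Equiv.Perm (Fin (2*l))) (v w : Fin l → ℤ) :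
    actD l σ (v - w) = actD l σ v - actD l σ w := by
  ext k
  simp only [actD, Pi.sub_apply, sub_mul, Finset.sum_sub_distrib]

lemma actD_neg (l : ℕ) (σ : Equiv.Perm (Fin (2*l))) (v : Fin l → ℤ) :
    actD l σ (-v) = -actD l σ v := by
  ext k
  simp only [actD, Pi.neg_apply, neg_mul, Finset.sum_neg_distrib]

lemma actD_epsD {l : ℕ} {σ : Equiv.Perm (Fin (2*l))} (hσ : IsSigned l σ) (x : Fin (2*l)) :
    actD l σ (epsD l x) = epsD l (σ x) := by
  have key : ∀ x : Fin (2*l), (x : ℕ) < l → actD l σ (epsD l x) = epsD l (σ x) := by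
    intro x hx
    ext k
    simp only [actD]
    rw [Finset.sum_eq_single (⟨x, hx⟩ : Fin l)]
    · simp [epsD]
    · intro i _ hi
      have : epsD l x i = 0 := by
        have := i.isLt
        rw [Ne, Fin.ext_iff] at hi
        simp only [epsD]
        simp only at hi
        rw [if_neg (by omega), if_neg (by omega)]
      rw [this, zero_mul]
    · simp
  by_cases hx : (x : ℕ) < l
  · exact key x hx
  · have := key (revF l x) (by simp only [revF]; omega)
    rw [epsD_revF, actD_neg, hσ, epsD_revF] at this
    exact neg_injective this

lemma actD_root {l : ℕ} {σ : Equiv.Perm (Fin (2*l))} (hσ : IsSigned l σ) (i j : Fin (2*l)) :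
    actD l σ (epsD l i - epsD l j) = epsD l (σ i) - epsD l (σ j) := by
  rw [actD_sub, actD_epsD hσ, actD_epsD hσ]

lemma not_isPosRootD_and_isNegRootD {l : ℕ} {v : Fin l → ℤ} (hp : isPosRootD l v)
    (hn : isNegRootD l v) : False := by
  obtain ⟨-, i, hi, hi'⟩ := hp
  obtain ⟨-, j, hj, hj'⟩ := hn
  rcases lt_trichotomy (i : ℕ) j with h | h | h
  · have := hj' i h; omega
  · have : i = j := Fin.ext h
    subst this; omega
  · have := hi' j h; omega

lemma isNegRootD_neg {l : ℕ} {v : Fin l → ℤ} : isNegRootD l (-v) ↔ isPosRootD l v := by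
  have key : ∀ v : Fin l → ℤ, isRootD l v → isRootD l (-v) := by
    rintro v ⟨i, j, hij, a, b, ha, hb, rfl⟩
    refine ⟨i, j, hij, -a, -b, by omega, by omega, ?_⟩
    ext k
    simp only [Pi.neg_apply]
    split_ifs <;> simp
  constructor
  · rintro ⟨h, i, hi, hi'⟩
    refine ⟨by simpa using key _ h, i, ?_, fun j hj => ?_⟩
    · simp only [Pi.neg_apply] at hi; omega
    · have := hi' j hj; simp only [Pi.neg_apply] at this; omega
  · rintro ⟨h, i, hi, hi'⟩
    refine ⟨key _ h, i, ?_, fun j hj => ?_⟩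
    · simp only [Pi.neg_apply]; omega
    · have := hi' j hj; simp only [Pi.neg_apply]; omega

lemma isPosRootD_epsD {l : ℕ} {i j : Fin (2*l)} (hij : i < j) (hne : i ≠ revF l j) :
    isPosRootD l (epsD l i - epsD l j) := by
  have key : ∀ i j : Fin (2*l), i < j → (i : ℕ) + j < 2*l-1 →
      isPosRootD l (epsD l i - epsD l j) := by
    intro i j hij hs
    rw [Fin.lt_def] at hij
    have := j.isLt
    have hil : (i : ℕ) < l := by omega
    refine ⟨?_, ⟨i, hil⟩, ?_, ?_⟩
    · by_cases hj : (j : ℕ) < l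
      · refine ⟨⟨i, hil⟩, ⟨j, hj⟩, hij, 1, -1, by simp, by simp, ?_⟩
        ext k
        have := k.isLt
        simp only [epsD, Pi.sub_apply, Fin.ext_iff]
        split_ifs <;> omega
      · refine ⟨⟨i, hil⟩, ⟨revF l j, by simp only [revF]; omega⟩, ?_, 1, 1, by simp, by simp, ?_⟩
        · simp only [revF]; omega
        ext k
        have := k.isLt
        simp only [epsD, Pi.sub_apply, Fin.ext_iff, revF]
        split_ifs <;> omega
    · simp only [epsD, Pi.sub_apply]
      split_ifs <;> omega
    · intro k hk
      simp only at hk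
      simp only [epsD, Pi.sub_apply]
      split_ifs <;> omega
  rw [Ne, Fin.ext_iff] at hne
  simp only [revF] at hne
  by_cases hs : (i : ℕ) + j < 2*l-1
  · exact key i j hij hs
  · have := key (revF l j) (revF l i) (revF_lt.2 hij)
      (by have := i.isLt; simp only [revF]; omega)
    rw [epsD_revF, epsD_revF] at this
    convert this using 1
    ring

lemma isNegRootD_epsD {l : ℕ} {i j : Fin (2*l)} (hij : j < i) (hne : i ≠ revF l j) :
    isNegRootD l (epsD l i - epsD l j) := by
  have := isNegRootD_neg.2 (isPosRootD_epsD hij (ne_revF_symm hne))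
  rwa [neg_sub] at this

lemma isPosRootD_epsD_iff {l : ℕ} {i j : Fin (2*l)} (h : i ≠ j) (hne : i ≠ revF l j) :
    isPosRootD l (epsD l i - epsD l j) ↔ i < j := by
  refine ⟨fun hp => ?_, fun hij => isPosRootD_epsD hij hne⟩
  by_contra hij
  exact not_isPosRootD_and_isNegRootD hp
    (isNegRootD_epsD (lt_of_le_of_ne (not_lt.1 hij) h.symm) hne)

lemma isNegRootD_epsD_iff {l : ℕ} {i j : Fin (2*l)} (h : i ≠ j) (hne : i ≠ revF l j) :
    isNegRootD l (epsD l i - epsD l j) ↔ j < i := by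
  refine ⟨fun hp => ?_, fun hij => isNegRootD_epsD hij hne⟩
  by_contra hij
  exact not_isPosRootD_and_isNegRootD
    (isPosRootD_epsD (lt_of_le_of_ne (not_lt.1 hij) h) hne) hp

lemma isPosRootD.exists_epsD {l : ℕ} {v : Fin l → ℤ} (h : isPosRootD l v) :
    ∃ i j : Fin (2*l), i < j ∧ i ≠ revF l j ∧ v = epsD l i - epsD l j := by
  obtain ⟨⟨i, j, hij, a, b, ha, hb, rfl⟩, m, hm, hm'⟩ := h
  have hi := i.isLt
  have hj := j.isLt
  have ha1 : a = 1 := by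
    rcases ha with rfl | rfl
    · rfl
    · rcases lt_trichotomy (m : ℕ) i with h | h | h
      · simp only [Fin.ext_iff] at hm; rw [if_neg (by omega), if_neg (by omega)] at hm; omega
      · simp only [Fin.ext_iff] at hm; rw [if_pos (by omega)] at hm; omega
      · have := hm' i h; simp at this
  subst ha1
  rcases hb with rfl | rfl
  · refine ⟨⟨i, by omega⟩, ⟨2*l-1-j, by omega⟩, ?_, ?_, ?_⟩
    · rw [Fin.lt_def]; simp only; omega
    · rw [Ne, Fin.ext_iff]; simp only [revF]; omega
    · ext k
      have := k.isLt
      simp only [epsD, Pi.sub_apply, Fin.ext_iff]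
      split_ifs <;> omega
  · refine ⟨⟨i, by omega⟩, ⟨j, by omega⟩, hij, ?_, ?_⟩
    · rw [Ne, Fin.ext_iff]; simp only [revF]; omega
    · ext k
      have := k.isLt
      simp only [epsD, Pi.sub_apply, Fin.ext_iff]
      split_ifs <;> omega

lemma finite_isPosRootD (l : ℕ) : {v | isPosRootD l v}.Finite := by
  refine (Set.finite_range fun ij : Fin (2*l) × Fin (2*l) => epsD l ij.1 - epsD l ij.2).subset ?_
  intro v hv
  obtain ⟨i, j, -, -, rfl⟩ := isPosRootD.exists_epsD hv
  exact ⟨(i, j), rfl⟩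

/-! ### Lengths -/

/-- The positive roots made negative by `x`. -/
def invSetD (l : ℕ) (x : Equiv.Perm (Fin (2*l))) : Set (Fin l → ℤ) :=
  {v | isPosRootD l v ∧ isNegRootD l (actD l x v)}

lemma finite_invSetD (l : ℕ) (x : Equiv.Perm (Fin (2*l))) : (invSetD l x).Finite :=
  (finite_isPosRootD l).subset fun _ hv => hv.1

lemma lenD_le (l : ℕ) (x : Equiv.Perm (Fin (2*l))) :
    lenD l x ≤ {v | isPosRootD l v}.ncard :=
  Set.ncard_le_ncard (fun _ hv => hv.1) (finite_isPosRootD l)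

lemma epsD_mem_invSetD_iff {l : ℕ} {x : Equiv.Perm (Fin (2*l))} (hx : IsSigned l x)
    {i j : Fin (2*l)} (h : i ≠ j) (hne : i ≠ revF l j) :
    epsD l i - epsD l j ∈ invSetD l x ↔ i < j ∧ x j < x i := by
  have h1 : x i ≠ revF l (x j) := by rw [← hx]; exact fun h' => hne (x.injective h')
  rw [invSetD, Set.mem_ofPred_eq, isPosRootD_epsD_iff h hne, actD_root hx,
    isNegRootD_epsD_iff (fun h' => h (x.injective h')) h1]

lemma lenD_lt_lenD_mul_reflD {l : ℕ} {x : Equiv.Perm (Fin (2*l))} (hx : IsSigned l x)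
    {p q : Fin (2*l)} (hpq : p < q) (hne : p ≠ revF l q) (hxpq : x p < x q) :
    lenD l x < lenD l (x * reflD l p q) := by
  classical
  have ht := isSigned_reflD hne
  set t := reflD l p q with ht_def
  have htt : ∀ i, t (t i) = i := reflD_apply_apply hne
  have hxt := hx.mul ht
  have htne : ∀ {i j : Fin (2*l)}, i ≠ revF l j → t i ≠ revF l (t j) := fun h => by
    rw [← ht]; exact fun h' => h (t.injective h')
  let f : (Fin l → ℤ) → (Fin l → ℤ) := fun v => if isPosRootD l (actD l t v) then actD l t v else v
  have hinvol : ∀ v, isPosRootD l v → actD l t (actD l t v) = v := by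
    intro v hv
    obtain ⟨i, j, hij, hnij, rfl⟩ := hv.exists_epsD
    rw [actD_root ht, actD_root ht, htt, htt]
  have hinj : Set.InjOn f (invSetD l x) := by
    rintro v ⟨hv, -⟩ w ⟨hw, -⟩ hvw
    simp only [f] at hvw
    split_ifs at hvw with h1 h2 h2
    · rw [← hinvol v hv, hvw, hinvol w hw]
    · rw [← hvw, hinvol v hv] at h2; exact absurd hv h2
    · rw [hvw, hinvol w hw] at h1; exact absurd hw h1
    · exact hvw
  have hmaps : f '' invSetD l x ⊆ invSetD l (x * t) := by
    rintro _ ⟨v, hv, rfl⟩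
    obtain ⟨i, j, hij, hnij, rfl⟩ := hv.1.exists_epsD
    have hv' := ((epsD_mem_invSetD_iff hx hij.ne hnij).1 hv).2
    have htij : t i ≠ t j := fun h => hij.ne (t.injective h)
    simp only [f, actD_root ht, isPosRootD_epsD_iff htij (htne hnij)]
    split_ifs with h
    · rw [epsD_mem_invSetD_iff hxt htij (htne hnij)]
      refine ⟨h, ?_⟩
      simpa only [Equiv.Perm.mul_apply, htt] using hv'
    · rw [epsD_mem_invSetD_iff hxt hij.ne hnij]
      exact ⟨hij, reflD_inversion hx hpq hne hxpq hij
        (lt_of_le_of_ne (not_lt.1 h) htij.symm) hv'⟩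
  have hnew : epsD l p - epsD l q ∈ invSetD l (x * t) := by
    rw [epsD_mem_invSetD_iff hxt hpq.ne hne]
    refine ⟨hpq, ?_⟩
    rwa [Equiv.Perm.mul_apply, Equiv.Perm.mul_apply, reflD_left hne, reflD_right hne]
  have hnot : epsD l p - epsD l q ∉ f '' invSetD l x := by
    rintro ⟨v, hv, hfv⟩
    have hneg : isNegRootD l (actD l t (epsD l p - epsD l q)) := by
      rw [actD_root ht, reflD_left hne, reflD_right hne]
      exact isNegRootD_epsD hpq (ne_revF_symm hne)
    simp only [f] at hfv
    split_ifs at hfv with h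
    · rw [← hfv, hinvol v hv.1] at hneg
      exact not_isPosRootD_and_isNegRootD hv.1 hneg
    · rw [hfv, epsD_mem_invSetD_iff hx hpq.ne hne] at hv
      exact absurd hv.2 (not_lt.2 hxpq.le)
  change (invSetD l x).ncard < (invSetD l (x * t)).ncard
  rw [← hinj.ncard_image]
  exact Set.ncard_lt_ncard ⟨hmaps, fun h => hnot (h hnew)⟩ (finite_invSetD l _)

/-! ### The Bruhat order and block ranks -/

lemma bruhatLE_mul_reflD {l : ℕ} {x : Equiv.Perm (Fin (2*l))} (hx : IsSigned l x)
    {p q : Fin (2*l)} (hpq : p < q) (hne : p ≠ revF l q) (hxpq : x p < x q) :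
    bruhatLE l x (x * reflD l p q) := by
  refine Relation.ReflTransGen.single ⟨⟨reflD l (x p) (x q), ⟨x p, x q, hxpq.ne, ?_, rfl⟩, ?_⟩,
    lenD_lt_lenD_mul_reflD hx hpq hne hxpq⟩
  · rw [← hx]; exact fun h => hne (x.injective h)
  · exact hx.mul_reflD p q

/-- A step of the Bruhat order is right multiplication by a reflection in a pair of positions
at which the values are increasing. -/
lemma exists_mul_reflD_of_step {l : ℕ} {x y : Equiv.Perm (Fin (2*l))} (hx : IsSigned l x)
    (h : (∃ τ, isReflD l τ ∧ y = τ * x) ∧ lenD l x < lenD l y) :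
    ∃ p q, p < q ∧ p ≠ revF l q ∧ x p < x q ∧ y = x * reflD l p q := by
  obtain ⟨⟨_, ⟨a, b, hab, hab', rfl⟩, hy⟩, hlen⟩ := h
  have key : ∀ p q, p < q → p ≠ revF l q → y = x * reflD l p q → x p < x q := by
    intro p q hpq hne hy
    by_contra hcon
    have hlt : x q < x p :=
      lt_of_le_of_ne (not_lt.1 hcon) fun h => hpq.ne' (x.injective h)
    have hysigned : IsSigned l y := hy ▸ hx.mul (isSigned_reflD hne)
    have h1 : y p < y q := by
      rw [hy, Equiv.Perm.mul_apply, Equiv.Perm.mul_apply, reflD_left hne, reflD_right hne]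
      exact hlt
    have h2 := lenD_lt_lenD_mul_reflD hysigned hpq hne h1
    rw [hy, mul_assoc, reflD_mul_self hne, mul_one, ← hy] at h2
    exact absurd h2 hlen.asymm
  obtain ⟨p, rfl⟩ := x.surjective a
  obtain ⟨q, rfl⟩ := x.surjective b
  have hpq : p ≠ q := fun h => hab (by rw [h])
  have hne : p ≠ revF l q := fun h => hab' (by rw [h, hx])
  have hy' : y = x * reflD l p q := by rw [hx.mul_reflD]; exact hy
  rcases lt_or_gt_of_ne hpq with h | h
  · exact ⟨p, q, h, hne, key p q h hne hy', hy'⟩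
  · rw [reflD_comm] at hy'
    exact ⟨q, p, h, ne_revF_symm hne, key q p h (ne_revF_symm hne) hy', hy'⟩

/-- The number of positions in blocks before `b` with value in blocks from `a` on. -/
def blockRank (l n a b : ℕ) (x : Equiv.Perm (Fin (2*l))) : ℤ :=
  ∑ i : Fin (2*l), (if blkP l n i < b then 1 else 0) * (if a ≤ blkP l n (x i) then 1 else 0)

lemma blkP_mono {l n : ℕ} (hnl : n ≤ l) {x y : ℕ} (h : x ≤ y) : blkP l n x ≤ blkP l n y := by
  unfold blkP; split_ifs <;> omega

lemma blockRank_le_mul_swap {l n : ℕ} (hnl : n ≤ l) (a b : ℕ) {x : Equiv.Perm (Fin (2*l))}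
    {p q : Fin (2*l)} (hpq : p < q) (hxpq : x p < x q) :
    blockRank l n a b x ≤ blockRank l n a b (x * Equiv.swap p q) := by
  rw [← sub_nonneg, blockRank, blockRank, ← Finset.sum_sub_distrib,
    Finset.sum_eq_add p q hpq.ne]
  · simp only [Equiv.Perm.mul_apply, Equiv.swap_apply_left, Equiv.swap_apply_right]
    have h1 := blkP_mono hnl (Fin.le_def.1 hpq.le)
    have h2 := blkP_mono hnl (Fin.le_def.1 hxpq.le)
    split_ifs <;> omega
  · rintro i - ⟨h1, h2⟩
    rw [Equiv.Perm.mul_apply, Equiv.swap_apply_of_ne_of_ne h1 h2, sub_self]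
  · simp
  · simp

lemma blockRank_le_mul_reflD {l n : ℕ} (hnl : n ≤ l) (a b : ℕ) {x : Equiv.Perm (Fin (2*l))}
    (hx : IsSigned l x) {p q : Fin (2*l)} (hpq : p < q) (hne : p ≠ revF l q)
    (hxpq : x p < x q) :
    blockRank l n a b x ≤ blockRank l n a b (x * reflD l p q) := by
  refine (blockRank_le_mul_swap hnl a b hpq hxpq).trans ?_
  rw [reflD, ← mul_assoc, Equiv.swap_comm (revF l p)]
  refine blockRank_le_mul_swap hnl a b (revF_lt.2 hpq) ?_
  rw [Equiv.Perm.mul_apply, Equiv.Perm.mul_apply,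
    Equiv.swap_apply_of_ne_of_ne (ne_revF_symm (ne_revF_symm hne)).symm (revF_ne l q),
    Equiv.swap_apply_of_ne_of_ne (revF_ne l p) (ne_revF_symm hne).symm, hx, hx, revF_lt]
  exact hxpq

lemma blockRank_le_of_bruhatLE {l n : ℕ} (hnl : n ≤ l) (a b : ℕ)
    {x y : Equiv.Perm (Fin (2*l))} (hx : IsSigned l x) (h : bruhatLE l x y) :
    IsSigned l y ∧ blockRank l n a b x ≤ blockRank l n a b y := by
  induction h with
  | refl => exact ⟨hx, le_rfl⟩
  | tail _ hstep ih =>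
    obtain ⟨p, q, hpq, hne, hlt, rfl⟩ := exists_mul_reflD_of_step ih.1 hstep
    exact ⟨ih.1.mul (isSigned_reflD hne),
      ih.2.trans (blockRank_le_mul_reflD hnl a b ih.1 hpq hne hlt)⟩

/-- Block ranks determine the block pattern of a permutation once this pattern is constant on
blocks. -/
lemma blkP_eq_of_blockRank_eq {l n : ℕ} {x y : Equiv.Perm (Fin (2*l))}
    (hy : ∀ i j : Fin (2*l), blkP l n i = blkP l n j → blkP l n (y i) = blkP l n (y j))
    (h : ∀ a b, blockRank l n a b x = blockRank l n a b y) (i : Fin (2*l)) :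
    blkP l n (x i) = blkP l n (y i) := by
  have hdiff : ∀ (z : Equiv.Perm (Fin (2*l))) (a b : ℕ),
      blockRank l n a (b+1) z - blockRank l n a b z =
        ((Finset.univ.filter fun j : Fin (2*l) => blkP l n j = b ∧ a ≤ blkP l n (z j)).card : ℤ) := by
    intro z a b
    rw [blockRank, blockRank, ← Finset.sum_sub_distrib, Finset.card_filter, Nat.cast_sum]
    refine Finset.sum_congr rfl fun j _ => ?_
    split_ifs <;> omega
  have hcard : ∀ a b,
      (Finset.univ.filter fun j : Fin (2*l) => blkP l n j = b ∧ a ≤ blkP l n (x j)).card =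
      (Finset.univ.filter fun j : Fin (2*l) => blkP l n j = b ∧ a ≤ blkP l n (y j)).card := by
    intro a b
    have := hdiff x a b
    rw [h, h, hdiff y a b] at this
    exact_mod_cast this.symm
  apply le_antisymm
  · by_contra hcon
    have h1 := hcard (blkP l n (y i) + 1) (blkP l n i)
    have h2 : (Finset.univ.filter fun j : Fin (2*l) => blkP l n j = blkP l n i ∧
        blkP l n (y i) + 1 ≤ blkP l n (y j)) = ∅ := by
      refine Finset.filter_eq_empty_iff.2 fun j _ hj => ?_
      have := hy j i hj.1
      omega
    rw [h2, Finset.card_empty, Finset.card_eq_zero] at h1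
    exact Finset.filter_eq_empty_iff.1 h1 (Finset.mem_univ i) ⟨rfl, by omega⟩
  · have h1 := hcard (blkP l n (y i)) (blkP l n i)
    have h2 : (Finset.univ.filter fun j : Fin (2*l) => blkP l n j = blkP l n i ∧
        blkP l n (y i) ≤ blkP l n (x j)) =
        Finset.univ.filter fun j : Fin (2*l) => blkP l n j = blkP l n i := by
      refine Finset.eq_of_subset_of_card_le
        (Finset.monotone_filter_right _ fun j _ hj => hj.1) ?_
      rw [h1]
      refine Finset.card_le_card fun j hj => ?_
      simp only [Finset.mem_filter, Finset.mem_univ, true_and] at hj ⊢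
      exact ⟨hj, (hy j i hj).ge⟩
    have h3 : i ∈ Finset.univ.filter fun j : Fin (2*l) => blkP l n j = blkP l n i := by simp
    rw [← h2] at h3
    exact (Finset.mem_filter.1 h3).2.2

/-! ### The double coset of `w̃_n` -/

lemma wtnPerm_val {l n : ℕ} (h : n + 1 ≤ l) (i : Fin (2*l)) :
    ((wtnPerm l n i : Fin (2*l)) : ℕ) = wtnFun l n i := by
  rw [wtnPerm, dif_pos h]; rfl

lemma wlongLnPerm_val {l n : ℕ} (h : n ≤ l) (i : Fin (2*l)) :
    ((wlongLnPerm l n i : Fin (2*l)) : ℕ) = wlongLnFun l n i := by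
  rw [wlongLnPerm, dif_pos h]; rfl

lemma wtnPerm_apply_apply {l n : ℕ} (h : n + 1 ≤ l) (i : Fin (2*l)) :
    wtnPerm l n (wtnPerm l n i) = i := by
  ext; rw [wtnPerm_val h, wtnPerm_val h, wtnFun_invol l n h _ i.isLt]

lemma wtnPerm_mul_self {l n : ℕ} (h : n + 1 ≤ l) : wtnPerm l n * wtnPerm l n = 1 :=
  Equiv.ext (wtnPerm_apply_apply h)

lemma isSigned_wtnPerm {l n : ℕ} (h : n + 1 ≤ l) : IsSigned l (wtnPerm l n) := fun i => by
  have := i.isLt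
  ext; rw [wtnPerm_val h]; simp only [revF, wtnPerm_val h]
  unfold wtnFun; split_ifs <;> omega

lemma isSigned_wlongLnPerm {l n : ℕ} (h : n ≤ l) : IsSigned l (wlongLnPerm l n) := fun i => by
  have := i.isLt
  ext; rw [wlongLnPerm_val h]; simp only [revF, wlongLnPerm_val h]
  unfold wlongLnFun; split_ifs <;> omega

lemma blkP_revF {l n : ℕ} (h : n + 1 ≤ l) (i : Fin (2*l)) :
    blkP l n (revF l i) = 2*l - 2*n + 1 - blkP l n i := by
  have := i.isLt
  simp only [revF]; unfold blkP; split_ifs <;> omega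

/-- The block of a value of `w̃_n` only depends on the block of the argument. -/
lemma blkP_wtnPerm_congr {l n : ℕ} (h : n + 1 ≤ l) {i j : Fin (2*l)}
    (hij : blkP l n i = blkP l n j) :
    blkP l n (wtnPerm l n i) = blkP l n (wtnPerm l n j) := by
  have := i.isLt
  have := j.isLt
  have h2l : l < 2*l - n := by omega
  have key : ((i : ℕ) < n ∧ (j : ℕ) < n) ∨ (2*l-n ≤ (i:ℕ) ∧ 2*l-n ≤ (j:ℕ)) ∨ i = j := by
    rw [Fin.ext_iff]; unfold blkP at hij; split_ifs at hij <;> omega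
  rcases key with ⟨h1, h2⟩ | ⟨h1, h2⟩ | rfl
  · rw [wtnPerm_val h, wtnPerm_val h, wtnFun, wtnFun, if_pos h1, if_pos h2]
    unfold blkP; split_ifs <;> omega
  · have h3 : ¬ (i : ℕ) < n := by omega
    have h4 : ¬ (j : ℕ) < n := by omega
    rw [wtnPerm_val h, wtnPerm_val h, wtnFun, wtnFun, if_neg h3, if_neg h4,
      if_pos h1, if_pos h2]
    unfold blkP; split_ifs <;> omega
  · rfl

/-- `w̃_n` is increasing on each block. -/
lemma wtnPerm_lt_of_blkP_eq {l n : ℕ} (h : n + 1 ≤ l) {i j : Fin (2*l)}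
    (hb : blkP l n i = blkP l n j) (hij : i < j) : wtnPerm l n i < wtnPerm l n j := by
  have := i.isLt
  have := j.isLt
  rw [Fin.lt_def] at *
  have h2l : l < 2*l - n := by omega
  have key : ((i : ℕ) < n ∧ (j : ℕ) < n) ∨ (2*l-n ≤ (i:ℕ) ∧ 2*l-n ≤ (j:ℕ)) := by
    unfold blkP at hb; split_ifs at hb <;> omega
  rw [wtnPerm_val h, wtnPerm_val h]
  rcases key with ⟨h1, h2⟩ | ⟨h1, h2⟩
  · rw [wtnFun, wtnFun, if_pos h1, if_pos h2]; omega
  · have h3 : ¬ (i : ℕ) < n := by omega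
    have h4 : ¬ (j : ℕ) < n := by omega
    rw [wtnFun, wtnFun, if_neg h3, if_neg h4, if_pos h1, if_pos h2]; omega

/-- The elements of `W_L w̃_n W_L`: signed permutations with the block pattern of `w̃_n`. -/
def InCoset (l n : ℕ) (x : Equiv.Perm (Fin (2*l))) : Prop :=
  IsSigned l x ∧ ∀ i, blkP l n (x i) = blkP l n (wtnPerm l n i)

lemma blkP_of_isGLnBlock {l n : ℕ} (h : n + 1 ≤ l) {τ : Equiv.Perm (Fin (2*l))}
    (hτ : isGLnBlock l n τ) (i : Fin (2*l)) : blkP l n (τ i) = blkP l n i := by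
  obtain ⟨h1, h2, h3⟩ := hτ
  have hi := i.isLt
  by_cases hin : (i : ℕ) < n
  · have := h1 i hin
    rw [blkP, blkP, if_pos this, if_pos hin]
  by_cases hin' : (i : ℕ) < 2*l - n
  · rw [h2 i (by omega) hin']
  · have h4 := h1 (revF l i) (by simp only [revF]; omega)
    rw [h3] at h4
    have := (τ i).isLt
    simp only [revF] at h4
    unfold blkP; split_ifs <;> omega

lemma isGLnBlock_of_blkP {l n : ℕ} {τ : Equiv.Perm (Fin (2*l))} (hs : IsSigned l τ)
    (hb : ∀ i, blkP l n (τ i) = blkP l n i) : isGLnBlock l n τ := by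
  refine ⟨fun i hi => ?_, fun i hi hi' => ?_, hs⟩
  · have := hb i
    unfold blkP at this; split_ifs at this; omega
  · have := hb i
    ext; unfold blkP at this; split_ifs at this <;> omega

lemma InCoset.isGLnBlock {l n : ℕ} (h : n + 1 ≤ l) {x : Equiv.Perm (Fin (2*l))}
    (hx : InCoset l n x) : isGLnBlock l n (wtnPerm l n * x) := by
  refine isGLnBlock_of_blkP ((isSigned_wtnPerm h).mul hx.1) fun i => ?_
  rw [Equiv.Perm.mul_apply, blkP_wtnPerm_congr h (hx.2 i), wtnPerm_apply_apply h]

lemma inCoset_of_double_coset {l n : ℕ} (h : n + 1 ≤ l) {a b : Equiv.Perm (Fin (2*l))}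
    (ha : isGLnBlock l n a) (hb : isGLnBlock l n b) : InCoset l n (a * wtnPerm l n * b) := by
  refine ⟨(IsSigned.mul ha.2.2 (isSigned_wtnPerm h)).mul hb.2.2, fun i => ?_⟩
  rw [Equiv.Perm.mul_apply, Equiv.Perm.mul_apply, blkP_of_isGLnBlock h ha,
    blkP_wtnPerm_congr h (blkP_of_isGLnBlock h hb i)]

lemma inCoset_wtnPerm {l n : ℕ} (h : n + 1 ≤ l) : InCoset l n (wtnPerm l n) :=
  ⟨isSigned_wtnPerm h, fun _ => rfl⟩

lemma inCoset_wlongLnPerm_mul {l n : ℕ} (h : n + 1 ≤ l) :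
    InCoset l n (wlongLnPerm l n * wtnPerm l n) := by
  refine ⟨(isSigned_wlongLnPerm (by omega)).mul (isSigned_wtnPerm h), fun i => ?_⟩
  have := (wtnPerm l n i).isLt
  rw [Equiv.Perm.mul_apply, wlongLnPerm_val (by omega)]
  unfold blkP wlongLnFun; split_ifs <;> omega

/-- The Bruhat interval `[w̃_n, w_l^L w̃_n]` is contained in the double coset. -/
lemma inCoset_of_bruhatLE {l n : ℕ} (h : n + 1 ≤ l) {x : Equiv.Perm (Fin (2*l))}
    (h1 : bruhatLE l (wtnPerm l n) x) (h2 : bruhatLE l x (wlongLnPerm l n * wtnPerm l n)) :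
    InCoset l n x := by
  have hw := isSigned_wtnPerm h
  have hx : IsSigned l x := (blockRank_le_of_bruhatLE (n := n) (by omega) 0 0 hw h1).1
  refine ⟨hx, blkP_eq_of_blockRank_eq (fun i j => blkP_wtnPerm_congr h) fun a b => ?_⟩
  refine le_antisymm ?_ (blockRank_le_of_bruhatLE (by omega) a b hw h1).2
  refine (blockRank_le_of_bruhatLE (n := n) (by omega) a b hx h2).2.trans (le_of_eq ?_)
  simp only [blockRank, (inCoset_wlongLnPerm_mul h).2]

section InCoset

variable {l n : ℕ} {x : Equiv.Perm (Fin (2*l))} {p q : Fin (2*l)}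

lemma InCoset.le_val (h : n + 1 ≤ l) (hx : InCoset l n x) {i : Fin (2*l)} (hi : (i : ℕ) < n) :
    2*l - n ≤ (x i : ℕ) := by
  have := hx.2 i
  rw [wtnPerm_val h, wtnFun, if_pos hi] at this
  unfold blkP at this; split_ifs at this <;> omega

/-- Two elements of the double coset agree once they agree on the first block. -/
lemma InCoset.ext (h : n + 1 ≤ l) (hx : InCoset l n x) {y : Equiv.Perm (Fin (2*l))}
    (hy : InCoset l n y) (hxy : ∀ i : Fin (2*l), (i : ℕ) < n → x i = y i) : x = y := by
  refine Equiv.ext fun i => ?_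
  by_cases hi : (i : ℕ) < n
  · exact hxy i hi
  by_cases hi' : (i : ℕ) < 2*l - n
  · have h1 := hx.2 i
    rw [← hy.2 i] at h1
    have h2 := hy.2 i
    rw [wtnPerm_val h] at h2
    ext
    unfold blkP wtnFun at h2
    unfold blkP at h1
    split_ifs at h1 h2 <;> omega
  · have := hxy (revF l i) (by simp only [revF]; omega)
    rwa [hx.1, hy.1, revF_inj] at this

lemma InCoset.mul_reflD (h : n + 1 ≤ l) (hx : InCoset l n x)
    (hp : (p : ℕ) < n) (hq : (q : ℕ) < n) : InCoset l n (x * reflD l p q) := by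
  have hne : p ≠ revF l q := by
    rw [Ne, Fin.ext_iff]; simp only [revF]; omega
  refine ⟨hx.1.mul (isSigned_reflD hne), fun i => ?_⟩
  rw [Equiv.Perm.mul_apply, hx.2]
  apply blkP_wtnPerm_congr h
  have hpq : blkP l n p = blkP l n q := by rw [blkP, blkP, if_pos hp, if_pos hq]
  rcases reflD_cases hne i with ⟨rfl, h'⟩ | ⟨rfl, h'⟩ | ⟨rfl, h'⟩ | ⟨rfl, h'⟩ | h'
  all_goals rw [h']
  · exact hpq.symm
  · exact hpq
  · rw [blkP_revF h, blkP_revF h, hpq]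
  · rw [blkP_revF h, blkP_revF h, hpq]

lemma InCoset.range_first_block (h : n + 1 ≤ l) (hx : InCoset l n x) :
    Set.range (fun i : Fin n => x (Fin.castLE (by omega) i)) =
      {v : Fin (2*l) | 2*l - n ≤ (v : ℕ)} := by
  ext v
  constructor
  · rintro ⟨i, rfl⟩
    exact hx.le_val h i.isLt
  · intro hv
    obtain ⟨i, rfl⟩ := x.surjective v
    have hv' : 2*l - n ≤ (x i : ℕ) := hv
    have h1 := hx.2 i
    rw [wtnPerm_val h] at h1
    have hi : (i : ℕ) < n := by
      have := i.isLt
      unfold blkP wtnFun at h1; split_ifs at h1 <;> omega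
    exact ⟨⟨i, hi⟩, rfl⟩

lemma InCoset.eq_of_monotone (h : n + 1 ≤ l) (hx : InCoset l n x)
    (hmono : ∀ p q : Fin (2*l), p < q → (q : ℕ) < n → x p < x q) : x = wtnPerm l n := by
  refine hx.ext h (inCoset_wtnPerm h) fun i hi => ?_
  have h1 : StrictMono fun i : Fin n => x (Fin.castLE (by omega) i) :=
    fun p q hpq => hmono _ _ hpq q.isLt
  have h2 : StrictMono fun i : Fin n => wtnPerm l n (Fin.castLE (by omega) i) := by
    intro p q hpq
    refine wtnPerm_lt_of_blkP_eq h ?_ hpq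
    simp [blkP]
  exact congrFun ((h1.range_inj h2).1 (by
    rw [hx.range_first_block h, (inCoset_wtnPerm h).range_first_block h])) ⟨i, hi⟩

lemma InCoset.eq_of_antitone (h : n + 1 ≤ l) (hx : InCoset l n x)
    (hanti : ∀ p q : Fin (2*l), p < q → (q : ℕ) < n → x q < x p) :
    x = wlongLnPerm l n * wtnPerm l n := by
  refine hx.ext h (inCoset_wlongLnPerm_mul h) fun i hi => ?_
  have h1 : StrictAnti fun i : Fin n => x (Fin.castLE (by omega) i) :=
    fun p q hpq => hanti _ _ hpq q.isLt
  have h2 : StrictAnti fun i : Fin n =>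
      (wlongLnPerm l n * wtnPerm l n) (Fin.castLE (by omega) i) := by
    intro p q hpq
    have := q.isLt
    rw [Fin.lt_def] at *
    simp only [Equiv.Perm.mul_apply, wlongLnPerm_val (show n ≤ l by omega), wtnPerm_val h,
      Fin.val_castLE]
    unfold wlongLnFun wtnFun
    split_ifs <;> omega
  exact congrFun ((h1.range_inj h2).1 (by
    rw [hx.range_first_block h, (inCoset_wlongLnPerm_mul h).range_first_block h])) ⟨i, hi⟩

lemma ne_revF_of_lt (h : n + 1 ≤ l) (hpq : p < q) (hq : (q : ℕ) < n) : p ≠ revF l q := by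
  rw [Fin.lt_def] at hpq
  rw [Ne, Fin.ext_iff]; simp only [revF]; omega

lemma InCoset.wtnPerm_bruhatLE (h : n + 1 ≤ l) (hx : InCoset l n x) :
    bruhatLE l (wtnPerm l n) x := by
  induction hlen : lenD l x using Nat.strong_induction_on generalizing x with
  | _ m ih =>
    by_cases hmono : ∀ p q : Fin (2*l), p < q → (q : ℕ) < n → x p < x q
    · rw [hx.eq_of_monotone h hmono]
      exact Relation.ReflTransGen.refl
    · push Not at hmono
      obtain ⟨p, q, hpq, hq, hle⟩ := hmono
      have hne := ne_revF_of_lt h hpq hq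
      have hy := hx.mul_reflD h ((Fin.lt_def.1 hpq).trans hq) hq
      have hlt : (x * reflD l p q) p < (x * reflD l p q) q := by
        rw [Equiv.Perm.mul_apply, Equiv.Perm.mul_apply, reflD_left hne, reflD_right hne]
        exact lt_of_le_of_ne hle fun h' => hpq.ne' (x.injective h')
      have hback : x * reflD l p q * reflD l p q = x := by
        rw [mul_assoc, reflD_mul_self hne, mul_one]
      have h1 := bruhatLE_mul_reflD hy.1 hpq hne hlt
      have h2 := lenD_lt_lenD_mul_reflD hy.1 hpq hne hlt
      rw [hback] at h1 h2
      exact (ih _ (hlen ▸ h2) hy rfl).trans h1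

lemma InCoset.bruhatLE_wlongLnPerm_mul (h : n + 1 ≤ l) (hx : InCoset l n x) :
    bruhatLE l x (wlongLnPerm l n * wtnPerm l n) := by
  induction hlen : {v | isPosRootD l v}.ncard - lenD l x using Nat.strong_induction_on
    generalizing x with
  | _ m ih =>
    by_cases hanti : ∀ p q : Fin (2*l), p < q → (q : ℕ) < n → x q < x p
    · rw [hx.eq_of_antitone h hanti]
      exact Relation.ReflTransGen.refl
    · push Not at hanti
      obtain ⟨p, q, hpq, hq, hle⟩ := hanti
      have hne := ne_revF_of_lt h hpq hq
      have hy := hx.mul_reflD h ((Fin.lt_def.1 hpq).trans hq) hq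
      have hlt : x p < x q := lt_of_le_of_ne hle fun h' => hpq.ne (x.injective h')
      have h1 := bruhatLE_mul_reflD hx.1 hpq hne hlt
      have h2 := lenD_lt_lenD_mul_reflD hx.1 hpq hne hlt
      have h3 := lenD_le l (x * reflD l p q)
      exact h1.trans (ih _ (by omega) hy rfl)

end InCoset

/-- Lengths add up in products `w̃_n τ` with `τ ∈ W_L`. -/
lemma lenD_wtnPerm_mul {l n : ℕ} (h : n + 1 ≤ l) {τ : Equiv.Perm (Fin (2*l))}
    (hτ : isGLnBlock l n τ) :
    lenD l (wtnPerm l n * τ) = lenD l (wtnPerm l n) + lenD l τ := by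
  have hs : IsSigned l τ := hτ.2.2
  have hw := isSigned_wtnPerm h
  have hb := blkP_of_isGLnBlock h hτ
  have hmul := hw.mul hs
  have hinv := hs.inv
  have hcomp : ∀ i, τ (τ⁻¹ i) = i := fun i => by simp
  have hcomp' : ∀ i, τ⁻¹ (τ i) = i := fun i => by simp
  have hblk : ∀ {i j}, i < j → τ j < τ i → blkP l n i = blkP l n j := by
    intro i j hij hji
    refine le_antisymm (blkP_mono (by omega) (Fin.le_def.1 hij.le)) ?_
    rw [← hb i, ← hb j]
    exact blkP_mono (by omega) (Fin.le_def.1 hji.le)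
  have hwinv : ∀ {i j}, i < j → τ j < τ i → wtnPerm l n (τ j) < wtnPerm l n (τ i) :=
    fun hij hji => wtnPerm_lt_of_blkP_eq h (by rw [hb, hb, hblk hij hji]) hji
  have hinj : Set.InjOn (actD l τ⁻¹) (invSetD l (wtnPerm l n)) := by
    rintro v ⟨hv, -⟩ w ⟨hw, -⟩ hvw
    obtain ⟨i, j, -, -, rfl⟩ := hv.exists_epsD
    obtain ⟨i', j', -, -, rfl⟩ := hw.exists_epsD
    have := congrArg (actD l τ) hvw
    simpa only [actD_root hinv, actD_root hs, hcomp] using this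
  have hunion : invSetD l (wtnPerm l n * τ) =
      actD l τ⁻¹ '' invSetD l (wtnPerm l n) ∪ invSetD l τ := by
    ext v
    constructor
    · intro hv
      obtain ⟨i, j, hij, hne, rfl⟩ := hv.1.exists_epsD
      rw [epsD_mem_invSetD_iff hmul hij.ne hne] at hv
      have hne' : τ i ≠ revF l (τ j) := by rw [← hs]; exact fun h' => hne (τ.injective h')
      rcases lt_or_gt_of_ne fun h' => hij.ne (τ.injective h') with hlt | hlt
      · refine Or.inl ⟨epsD l (τ i) - epsD l (τ j), ?_, ?_⟩
        · rw [epsD_mem_invSetD_iff hw hlt.ne hne']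
          exact ⟨hlt, hv.2⟩
        · rw [actD_root hinv, hcomp', hcomp']
      · exact Or.inr ((epsD_mem_invSetD_iff hs hij.ne hne).2 ⟨hij, hlt⟩)
    · rintro (⟨v, hv, rfl⟩ | hv)
      · obtain ⟨i, j, hij, hne, rfl⟩ := hv.1.exists_epsD
        rw [epsD_mem_invSetD_iff hw hij.ne hne] at hv
        have hij' : τ⁻¹ i ≠ τ⁻¹ j := fun h' => hij.ne (τ⁻¹.injective h')
        have hne' : τ⁻¹ i ≠ revF l (τ⁻¹ j) := by
          rw [← hinv]; exact fun h' => hne (τ⁻¹.injective h')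
        rw [actD_root hinv, epsD_mem_invSetD_iff hmul hij' hne', Equiv.Perm.mul_apply,
          Equiv.Perm.mul_apply, hcomp, hcomp]
        refine ⟨?_, hv.2⟩
        by_contra hcon
        have hlt := lt_of_le_of_ne (not_lt.1 hcon) hij'.symm
        have := hwinv hlt (by rwa [hcomp, hcomp])
        rw [hcomp, hcomp] at this
        exact absurd hv.2 this.asymm
      · obtain ⟨i, j, hij, hne, rfl⟩ := hv.1.exists_epsD
        rw [epsD_mem_invSetD_iff hs hij.ne hne] at hv
        rw [epsD_mem_invSetD_iff hmul hij.ne hne]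
        exact ⟨hij, hwinv hij hv.2⟩
  have hdisj : Disjoint (actD l τ⁻¹ '' invSetD l (wtnPerm l n)) (invSetD l τ) := by
    rw [Set.disjoint_left]
    rintro _ ⟨v, hv, rfl⟩ ⟨-, hneg⟩
    obtain ⟨i, j, -, -, rfl⟩ := hv.1.exists_epsD
    rw [actD_root hinv, actD_root hs, hcomp, hcomp] at hneg
    exact not_isPosRootD_and_isNegRootD hv.1 hneg
  change (invSetD l (wtnPerm l n * τ)).ncard =
    (invSetD l (wtnPerm l n)).ncard + (invSetD l τ).ncard
  rw [hunion, Set.ncard_union_eq hdisj ((finite_invSetD l _).image _) (finite_invSetD l τ),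
    hinj.ncard_image]


/-! ### Signs and Weyl representatives -/

/-- The sign of a signed permutation is the parity of its number of sign changes. -/
lemma IsSigned.sign_eq_one {l : ℕ} {σ : Equiv.Perm (Fin (2*l))} (hs : IsSigned l σ)
    (he : Even (Finset.univ.filter
      (fun i : Fin (2*l) => (i:ℕ) < l ∧ l ≤ ((σ i : Fin (2*l)) : ℕ))).card) :
    Equiv.Perm.sign σ = 1 := by
  let f : Fin (2*l) × Fin (2*l) → ℤˣ := fun ij => if σ ij.1 < σ ij.2 then 1 else -1
  let P := Finset.univ.filter fun ij : Fin (2*l) × Fin (2*l) => ij.1 < ij.2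
  have h1 : Equiv.Perm.sign σ = ∏ ij ∈ P, f ij := by
    rw [σ.sign_eq_prod_prod_Iio, Finset.prod_sigma']
    refine Finset.prod_bij' (fun x _ => (x.2, x.1)) (fun x _ => ⟨x.2, x.1⟩) ?_ ?_ ?_ ?_ ?_ <;>
      simp [P, f]
  have h2 : ∏ ij ∈ P with ij.1 ≠ revF l ij.2, f ij = 1 := by
    refine Finset.prod_involution (fun ij _ => (revF l ij.2, revF l ij.1)) ?_ ?_ ?_ ?_
    · rintro ⟨i, j⟩ -
      simp only [f, hs _, revF_lt]
      split_ifs <;> simp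
    · rintro ⟨i, j⟩ hij - h
      simp only [Finset.mem_filter, ne_eq] at hij
      exact hij.2 (Prod.ext_iff.1 h).1.symm
    · rintro ⟨i, j⟩ hij
      simp only [P, Finset.mem_filter, Finset.mem_univ, true_and, revF_lt, revF_revF] at hij ⊢
      exact ⟨hij.1, fun h => hij.2 h.symm⟩
    · rintro ⟨i, j⟩ -
      simp only [revF_revF]
  have h3 : ∏ ij ∈ P with ¬ ij.1 ≠ revF l ij.2, f ij =
      ∏ i ∈ Finset.univ.filter (fun i : Fin (2*l) => (i : ℕ) < l), if l ≤ (σ i : ℕ) then -1 else 1 := by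
    refine Finset.prod_bij' (fun ij _ => ij.1) (fun i _ => (i, revF l i)) ?_ ?_ ?_ ?_ ?_
    · rintro ⟨i, j⟩ hij
      simp only [P, Finset.mem_filter, Finset.mem_univ, true_and, not_not] at hij ⊢
      obtain ⟨h, h'⟩ := hij
      have := j.isLt
      rw [Fin.lt_def] at h
      rw [Fin.ext_iff] at h'
      simp only [revF] at h'
      omega
    · intro i hi
      simp only [P, Finset.mem_filter, Finset.mem_univ, true_and, not_not, revF_revF] at hi ⊢
      rw [and_true, Fin.lt_def]; simp only [revF]; omega
    · rintro ⟨i, j⟩ hij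
      simp only [Finset.mem_filter, not_not] at hij
      simp only [hij.2, revF_revF]
    · simp
    · rintro ⟨i, j⟩ hij
      simp only [Finset.mem_filter, not_not] at hij
      have h : σ j = revF l (σ i) := by rw [← hs, hij.2, revF_revF]
      have := (σ i).isLt
      have h' : σ i < σ j ↔ ¬ l ≤ (σ i : ℕ) := by
        rw [h, Fin.lt_def]; simp only [revF]; omega
      simp only [f, h', ite_not]
  rw [h1, ← Finset.prod_filter_mul_prod_filter_not P (fun ij => ij.1 ≠ revF l ij.2), h2, h3,
    one_mul, Finset.prod_ite, Finset.prod_const, Finset.prod_const_one, mul_one,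
    Finset.filter_filter]
  exact he.neg_one_pow

section Matrices

variable {F : Type*} [Field F] {l n : ℕ}

/-- The permutation matrix sending `e_j` to `e_{σ j}`. -/
def weylMat (F : Type*) [Field F] (l : ℕ) (σ : Equiv.Perm (Fin (2*l))) :
    Matrix (Fin (2*l)) (Fin (2*l)) F := (σ⁻¹).permMatrix F

lemma weylMat_apply (σ : Equiv.Perm (Fin (2*l))) (i j : Fin (2*l)) :
    weylMat F l σ i j = if σ j = i then 1 else 0 := by
  rw [weylMat, Equiv.Perm.permMatrix, PEquiv.toMatrix_apply]
  simp only [Equiv.toPEquiv, PEquiv.coe_mk, Function.comp_apply, Option.mem_some_iff]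
  exact if_congr (by rw [Equiv.Perm.inv_eq_iff_eq, eq_comm]) rfl rfl

lemma weylMat_mul_apply (σ : Equiv.Perm (Fin (2*l))) (A : Matrix (Fin (2*l)) (Fin (2*l)) F)
    (i j : Fin (2*l)) : (weylMat F l σ * A) (σ i) j = A i j := by
  rw [Matrix.mul_apply, Finset.sum_eq_single i]
  · simp [weylMat_apply]
  · intro k _ hk
    rw [weylMat_apply, if_neg fun h => hk (σ.injective h), zero_mul]
  · simp

lemma isWeylRep_weylMat {σ : Equiv.Perm (Fin (2*l))} (hs : IsSigned l σ)
    (hsign : Equiv.Perm.sign σ = 1) : isWeylRep F l σ (weylMat F l σ) := by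
  refine ⟨⟨?_, ?_⟩, fun i j => ?_⟩
  · rw [weylMat, Matrix.det_permutation, Equiv.Perm.sign_inv, hsign]; simp
  · ext i j
    rw [mul_assoc, Matrix.mul_apply, Finset.sum_eq_single (σ i)]
    · rw [Matrix.mul_apply, Finset.sum_eq_single (σ j)]
      · have h := hs i
        have hj : (i : ℕ) + j + 1 = 2*l ↔ (σ i : ℕ) + σ j + 1 = 2*l := by
          have h1 : (i : ℕ) + j + 1 = 2*l ↔ revF l i = j := by
            have := i.isLt
            rw [Fin.ext_iff]; simp only [revF]; omega
          have h2 : (σ i : ℕ) + σ j + 1 = 2*l ↔ revF l (σ i) = σ j := by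
            have := (σ i).isLt
            rw [Fin.ext_iff]; simp only [revF]; omega
          rw [h1, h2, ← h, σ.injective.eq_iff]
        simp [weylMat_apply, Jmat, hj]
      · intro k _ hk
        rw [weylMat_apply, if_neg fun h => hk h.symm, mul_zero]
      · simp
    · intro k _ hk
      rw [Matrix.transpose_apply, weylMat_apply, if_neg fun h => hk h.symm, zero_mul]
    · simp
  · rw [weylMat_apply]; split_ifs with h <;> simp [h]

lemma inSO.mul {N : ℕ} {g h : Matrix (Fin N) (Fin N) F} (hg : inSO F N g) (hh : inSO F N h) :
    inSO F N (g * h) := by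
  refine ⟨by rw [Matrix.det_mul, hg.1, hh.1, mul_one], ?_⟩
  calc (g * h)ᵀ * Jmat F N * (g * h) = hᵀ * (gᵀ * Jmat F N * g) * h := by
        rw [Matrix.transpose_mul]; simp only [mul_assoc]
    _ = Jmat F N := by rw [hg.2, hh.2]

lemma inSO_one (N : ℕ) : inSO F N 1 := ⟨Matrix.det_one, by simp⟩

lemma inBorel_one (l : ℕ) : inBorel F l 1 :=
  ⟨inSO_one _, fun _ _ hij => Matrix.one_apply_ne fun h => by rw [h] at hij; omega⟩

lemma inBorel.inPn1 (hnl : n ≤ l) {b : Matrix (Fin (2*l)) (Fin (2*l)) F} (hb : inBorel F l b) :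
    inPn1 F l n b := by
  refine ⟨hb.1, fun i j hij => hb.2 i j ?_⟩
  by_contra hcon
  exact absurd (blkP_mono hnl (not_lt.1 hcon)) (not_le.2 hij)

lemma inPn1.mul {g h : Matrix (Fin (2*l)) (Fin (2*l)) F} (hg : inPn1 F l n g)
    (hh : inPn1 F l n h) : inPn1 F l n (g * h) := by
  have h1 : Matrix.BlockTriangular g fun i : Fin (2*l) => blkP l n i := fun i j => hg.2 i j
  have h2 : Matrix.BlockTriangular h fun i : Fin (2*l) => blkP l n i := fun i j => hh.2 i j
  exact ⟨hg.1.mul hh.1, fun i j hij => h1.mul h2 hij⟩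

/-- A permutation that weakly lowers a statistic at every point preserves it. -/
lemma Equiv.Perm.eq_of_forall_le {α : Type*} [Fintype α] (ρ : Equiv.Perm α) (f : α → ℕ)
    (h : ∀ i, f (ρ i) ≤ f i) (i : α) : f (ρ i) = f i :=
  (Finset.sum_eq_sum_iff_of_le fun i _ => h i).1 (Equiv.sum_comp ρ f) i (Finset.mem_univ i)

/-- A monomial matrix in `P w P` has the block pattern of `w`. -/
lemma blkP_eq_of_mul_eq {σ w : Equiv.Perm (Fin (2*l))}
    (hw : ∀ i j : Fin (2*l), blkP l n i = blkP l n j → blkP l n (w i) = blkP l n (w j))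
    {g gw p1 p2 : Matrix (Fin (2*l)) (Fin (2*l)) F} (hg : isWeylRep F l σ g)
    (hgw : isWeylRep F l w gw) (hp1 : inPn1 F l n p1) (hp2 : inPn1 F l n p2)
    (heq : g = p1 * gw * p2) (j : Fin (2*l)) : blkP l n (σ j) = blkP l n (w j) := by
  have hu : IsUnit p1.det := by rw [hp1.1.1]; exact isUnit_one
  let _ : Invertible p1 := Matrix.invertibleOfIsUnitDet p1 hu
  have hq : Matrix.BlockTriangular p1⁻¹ fun i : Fin (2*l) => blkP l n i :=
    Matrix.blockTriangular_inv_of_blockTriangular fun i j => hp1.2 i j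
  have hY : p1⁻¹ * g = gw * p2 := by
    rw [heq, mul_assoc p1, ← mul_assoc, Matrix.nonsing_inv_mul _ hu, one_mul]
  have hdet : (gw * p2).det ≠ 0 := by
    rw [Matrix.det_mul, hgw.1.1, hp2.1.1, mul_one]; exact one_ne_zero
  rw [Matrix.det_apply] at hdet
  obtain ⟨π, -, hπ⟩ := Finset.exists_ne_zero_of_sum_ne_zero hdet
  have hne : ∀ j, (gw * p2) (π j) j ≠ 0 := fun j hj =>
    hπ (smul_eq_zero_of_right _ (Finset.prod_eq_zero (Finset.mem_univ j) hj))
  have hle1 : ∀ j, blkP l n (π j) ≤ blkP l n (σ j) := by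
    intro j
    have h := hne j
    rw [← hY, Matrix.mul_apply] at h
    obtain ⟨k, -, hk⟩ := Finset.exists_ne_zero_of_sum_ne_zero h
    have hk2 : σ j = k := (hg.2 k j).1 (right_ne_zero_of_mul hk)
    by_contra hcon
    exact left_ne_zero_of_mul hk (hq (by rw [← hk2]; exact not_le.1 hcon))
  have hle2 : ∀ j, blkP l n (w⁻¹ (π j)) ≤ blkP l n j := by
    intro j
    have h := hne j
    rw [Matrix.mul_apply] at h
    obtain ⟨k, -, hk⟩ := Finset.exists_ne_zero_of_sum_ne_zero h
    have hk2 : w⁻¹ (π j) = k := by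
      rw [Equiv.Perm.inv_eq_iff_eq]; exact ((hgw.2 (π j) k).1 (left_ne_zero_of_mul hk)).symm
    by_contra hcon
    exact right_ne_zero_of_mul hk (hp2.2 k j (by rw [← hk2]; exact not_le.1 hcon))
  have h1 := (π * σ⁻¹).eq_of_forall_le (fun i => blkP l n i)
    (fun i => by simpa using hle1 (σ⁻¹ i)) (σ j)
  have h2 := (w⁻¹ * π).eq_of_forall_le (fun i => blkP l n i) (fun i => hle2 i) j
  have h3 := hw _ _ h2
  simp only [Equiv.Perm.mul_apply, Equiv.Perm.inv_def, Equiv.symm_apply_apply,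
    Equiv.apply_symm_apply] at h1 h3
  rw [← h1, h3]

lemma inCoset_of_bruhatCell_subset (h : n + 1 ≤ l) {σ : Equiv.Perm (Fin (2*l))}
    (hσ : inWeylD l σ) (hsub : bruhatCell F l σ ⊆ PwP F l n) : InCoset l n σ := by
  have hrep : isWeylRep F l σ (weylMat F l σ) :=
    isWeylRep_weylMat hσ.1 (IsSigned.sign_eq_one hσ.1 hσ.2)
  obtain ⟨p1, gw, p2, hp1, hgw, hp2, heq⟩ :=
    hsub ⟨1, weylMat F l σ, 1, inBorel_one l, hrep, inBorel_one l, rfl⟩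
  rw [one_mul, mul_one] at heq
  exact ⟨hσ.1, blkP_eq_of_mul_eq (fun i j => blkP_wtnPerm_congr h) hrep hgw hp1 hp2 heq⟩

lemma sign_eq_one_of_isGLnBlock (h : n + 1 ≤ l) {τ : Equiv.Perm (Fin (2*l))}
    (hτ : isGLnBlock l n τ) : Equiv.Perm.sign τ = 1 := by
  refine IsSigned.sign_eq_one hτ.2.2 ?_
  rw [Finset.filter_eq_empty_iff.2 fun i _ hi => ?_]
  · simp
  by_cases hin : (i : ℕ) < n
  · have := hτ.1 i hin; omega
  · rw [hτ.2.1 i (by omega) (by omega)] at hi; omega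

lemma bruhatCell_subset_of_inCoset (h : n + 1 ≤ l) {σ : Equiv.Perm (Fin (2*l))}
    (hσ : inWeylD l σ) (hc : InCoset l n σ) : bruhatCell F l σ ⊆ PwP F l n := by
  have hτ := hc.isGLnBlock h
  have hsign : Equiv.Perm.sign (wtnPerm l n) = 1 := by
    have := sign_eq_one_of_isGLnBlock h hτ
    rwa [map_mul, IsSigned.sign_eq_one hσ.1 hσ.2, mul_one] at this
  have hw : isWeylRep F l (wtnPerm l n) (weylMat F l (wtnPerm l n)) :=
    isWeylRep_weylMat (isSigned_wtnPerm h) hsign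
  have hsq : weylMat F l (wtnPerm l n) * weylMat F l (wtnPerm l n) = 1 := by
    ext i j
    have := weylMat_mul_apply (F := F) (wtnPerm l n) (weylMat F l (wtnPerm l n)) (wtnPerm l n i) j
    rw [wtnPerm_apply_apply h] at this
    rw [this, weylMat_apply, Matrix.one_apply]
    simp only [(wtnPerm l n).injective.eq_iff, eq_comm]
  rintro _ ⟨b1, gσ, b2, hb1, hgσ, hb2, rfl⟩
  refine ⟨b1, weylMat F l (wtnPerm l n), weylMat F l (wtnPerm l n) * gσ * b2,
    hb1.inPn1 (by omega), hw, inPn1.mul ⟨hw.1.mul hgσ.1, fun i j hij => ?_⟩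
      (hb2.inPn1 (by omega)), ?_⟩
  · have := weylMat_mul_apply (wtnPerm l n) gσ (wtnPerm l n i) j
    rw [wtnPerm_apply_apply h] at this
    rw [this]
    by_contra hne
    have h1 := (hgσ.2 _ _).1 hne
    have h2 := blkP_of_isGLnBlock h hτ j
    rw [Equiv.Perm.mul_apply, h1, wtnPerm_apply_apply h] at h2
    omega
  · calc b1 * gσ * b2
        = b1 * (weylMat F l (wtnPerm l n) * weylMat F l (wtnPerm l n)) * gσ * b2 := by
          rw [hsq, mul_one]
      _ = _ := by simp only [mul_assoc]

end Matrices

/-- for `n ≤ l-2`, `{w : C(w) ⊆ P_{n,1^{l-n}} w̃_n P_{n,1^{l-n}}}` equals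
the Bruhat interval `[w̃_n, w_l^L w̃_n]` (with `w_l^L` the long element of the Levi);
in particular `w̃_n` is minimal and `w_l^L w̃_n` maximal in the double coset
`W_L w̃_n W_L`, and each of its elements factors uniquely as `w̃_n w'`, `w' ∈ W_L`,
with `l(w̃_n w') = l(w̃_n) + l(w')`. -/
theorem statement14 (F : Type*) [Field F] [CharZero F] (l n : ℕ)
    (hn : 1 ≤ n) (hnl : n + 2 ≤ l) :
    (∀ σ : Equiv.Perm (Fin (2*l)), inWeylD l σ →
      ((bruhatCell F l σ ⊆ PwP F l n) ↔
        (bruhatLE l (wtnPerm l n) σ ∧ bruhatLE l σ (wlongLnPerm l n * wtnPerm l n)))) ∧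
    (∀ σ : Equiv.Perm (Fin (2*l)),
      (∃ a b, isGLnBlock l n a ∧ isGLnBlock l n b ∧ σ = a * wtnPerm l n * b) →
        (bruhatLE l (wtnPerm l n) σ ∧ bruhatLE l σ (wlongLnPerm l n * wtnPerm l n))) ∧
    (∀ σ : Equiv.Perm (Fin (2*l)),
      (∃ a b, isGLnBlock l n a ∧ isGLnBlock l n b ∧ σ = a * wtnPerm l n * b) →
        ∃! τ, isGLnBlock l n τ ∧ σ = wtnPerm l n * τ ∧
          lenD l σ = lenD l (wtnPerm l n) + lenD l τ) := by
  have h : n + 1 ≤ l := by omega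
  refine ⟨fun σ hσ => ⟨fun hsub => ?_, fun hbr => ?_⟩, ?_, ?_⟩
  · have hc := inCoset_of_bruhatCell_subset h hσ hsub
    exact ⟨hc.wtnPerm_bruhatLE h, hc.bruhatLE_wlongLnPerm_mul h⟩
  · exact bruhatCell_subset_of_inCoset h hσ (inCoset_of_bruhatLE h hbr.1 hbr.2)
  · rintro _ ⟨a, b, ha, hb, rfl⟩
    have hc := inCoset_of_double_coset h ha hb
    exact ⟨hc.wtnPerm_bruhatLE h, hc.bruhatLE_wlongLnPerm_mul h⟩
  · rintro σ ⟨a, b, ha, hb, hσ⟩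
    have hτ := (hσ ▸ inCoset_of_double_coset h ha hb : InCoset l n σ).isGLnBlock h
    have hfac : σ = wtnPerm l n * (wtnPerm l n * σ) := by
      rw [← mul_assoc, wtnPerm_mul_self h, one_mul]
    refine ⟨wtnPerm l n * σ, ⟨hτ, hfac, ?_⟩, fun τ hτ' => ?_⟩
    · rw [← lenD_wtnPerm_mul h hτ, ← hfac]
    · rw [hτ'.2.1, ← mul_assoc, wtnPerm_mul_self h, one_mul]

end
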